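/- Suppose f is μ-strongly convex with μ > 0 and attains its minimum at x* ∈ ℝ^d, and suppose v_j > 0 for all j ∈ {1,…,d}. Fix a stepsize h > 0 and points y, x̄ ∈ ℝ^d, and for each pair (i,j) with L_{ij} > 0 define G^{ij} := ∇_j f(x̄) + (1/(n q_{ij})) ( ∇_j f_i(y) − ∇_j f_i(x̄) ). Then the one-step recursion holds: (1/2) Σ_{j=1}^d Σ_{i : L_{ij} > 0} p_j q_{ij} ‖ y − h p_j^{-1} G^{ij} e_j − x* ‖² + h (1 − 2 h L̂) ( f(y) − f(x*) ) ≤ (1 − h μ) (1/2) ‖ y − x* ‖² + 2 h² L̂ ( f(x̄) − f(x*) ), where L̂ := (1/n) Σ_{j=1}^d v_j. -/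

import Mathlib

open RealInnerProductSpace

lemma aux_grad_ineq {d : ℕ} (f : EuclideanSpace ℝ (Fin d) → ℝ) (hd : Differentiable ℝ f)
    (hc : ConvexOn ℝ Set.univ f) (x y : EuclideanSpace ℝ (Fin d)) :
    f x + ⟪gradient f x, y - x⟫ ≤ f y := by
  have h1 : ConvexOn ℝ Set.univ (f ∘ (AffineMap.lineMap x y : ℝ →ᵃ[ℝ] _)) := by
    simpa using hc.comp_affineMap (AffineMap.lineMap x y : ℝ →ᵃ[ℝ] _)
  have h2 : HasDerivAt (f ∘ (AffineMap.lineMap x y : ℝ →ᵃ[ℝ] _)) (fderiv ℝ f x (y - x)) 0 := by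
    have h3 : HasFDerivAt f (fderiv ℝ f x) ((AffineMap.lineMap x y : ℝ →ᵃ[ℝ] _) (0:ℝ)) := by
      simpa using (hd x).hasFDerivAt
    exact h3.comp_hasDerivAt (0:ℝ) AffineMap.hasDerivAt_lineMap
  have h4 := h1.le_slope_of_hasDerivAt (Set.mem_univ (0:ℝ)) (Set.mem_univ (1:ℝ)) one_pos h2
  simp [slope_def_field] at h4
  rw [inner_gradient_left, map_sub]
  linarith

lemma aux_coord {d : ℕ} (f : EuclideanSpace ℝ (Fin d) → ℝ) (hd : Differentiable ℝ f)
    (hc : ConvexOn ℝ Set.univ f) (j : Fin d) (L : ℝ)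
    (hs : ∀ (x : EuclideanSpace ℝ (Fin d)) (h : ℝ),
      f (x + h • EuclideanSpace.single j 1) ≤
        f x + ⟪gradient f x, h • EuclideanSpace.single j 1⟫ + L / 2 * h ^ 2)
    (x z : EuclideanSpace ℝ (Fin d)) :
    (gradient f z j - gradient f x j) ^ 2 ≤
      2 * L * (f z - f x - ⟪gradient f x, z - x⟫) := by
  have key : ∀ t : ℝ, 0 ≤ (L / 2) * (t * t) + (gradient f z j - gradient f x j) * t
      + (f z - f x - ⟪gradient f x, z - x⟫) := by
    intro t
    have h1 := hs z t
    have h2 := aux_grad_ineq f hd hc x (z + t • EuclideanSpace.single j 1)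
    rw [show z + t • EuclideanSpace.single j 1 - x
      = (z - x) + t • (EuclideanSpace.single j 1 : EuclideanSpace ℝ (Fin d)) by abel,
      inner_add_right] at h2
    simp only [inner_smul_right, EuclideanSpace.inner_single_right, conj_trivial, one_mul] at h1 h2
    nlinarith
  have := discrim_le_zero key
  unfold discrim at this
  linarith

lemma aux_var {ι : Type*} (F : Finset ι) (q c G Dy Dx : ι → ℝ) (m : ℝ)
    (hq : ∀ i ∈ F, 0 ≤ q i) (hs : ∑ i ∈ F, q i = 1)
    (hm : ∑ i ∈ F, q i * (c i * Dx i) = m)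
    (hG : ∀ i ∈ F, G i = m + c i * (Dy i - Dx i)) :
    ∑ i ∈ F, q i * G i ^ 2 ≤
      2 * ∑ i ∈ F, q i * (c i * Dy i) ^ 2 + 2 * ∑ i ∈ F, q i * (c i * Dx i) ^ 2 := by
  have h1 : ∑ i ∈ F, q i * G i ^ 2 ≤ ∑ i ∈ F, (2 * (q i * (c i * Dy i) ^ 2)
      + 2 * (q i * (c i * Dx i) ^ 2) + (2 * m ^ 2 * q i - 4 * m * (q i * (c i * Dx i)))) := by
    refine Finset.sum_le_sum fun i hi => ?_
    rw [hG i hi]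
    nlinarith [mul_nonneg (hq i hi) (sq_nonneg (c i * Dy i - (m - c i * Dx i)))]
  rw [Finset.sum_add_distrib, Finset.sum_add_distrib, Finset.sum_sub_distrib,
    ← Finset.mul_sum, ← Finset.mul_sum, ← Finset.mul_sum, ← Finset.mul_sum, hs, hm] at h1
  nlinarith [sq_nonneg m]

lemma aux_second {n d : ℕ} (hn : 0 < n) (L : Fin n → Fin d → ℝ) 
    (ω : Fin n → ℝ)
    (hω : ∀ i, ω i = ((Finset.univ.filter fun j => L i j ≠ 0).card : ℝ))
    (hL : ∀ i j, 0 ≤ L i j)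
    (v p : Fin d → ℝ) (hvpos : ∀ j, 0 < v j) (S : ℝ) (hS : 0 < S) (hp : ∀ j, p j = v j / S)
    (q : Fin n → Fin d → ℝ) (hq : ∀ i j, 0 < L i j → q i j = ω i * L i j / v j)
    (D : Fin n → Fin d → ℝ) (Φ : Fin n → ℝ) (hΦ : ∀ i, 0 ≤ Φ i)
    (hD : ∀ i j, D i j ^ 2 ≤ 2 * L i j * Φ i) :
    ∑ j, (p j)⁻¹ * ∑ i ∈ Finset.univ.filter (fun i => 0 < L i j),
      q i j * (1 / (n * q i j) * D i j) ^ 2 ≤ 2 * (1 / n * S) * (1 / n * ∑ i, Φ i) := by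
  have hn' : (0:ℝ) < n := by exact_mod_cast hn
  have hωpos : ∀ i j, 0 < L i j → 0 < ω i := by
    intro i j h
    rw [hω]
    exact_mod_cast Finset.card_pos.2 ⟨j, by simp [h.ne']⟩
  have h1 : ∀ j, (p j)⁻¹ * ∑ i ∈ Finset.univ.filter (fun i => 0 < L i j),
      q i j * (1 / (n * q i j) * D i j) ^ 2 ≤
      ∑ i, if L i j ≠ 0 then 2 * S / n ^ 2 * (Φ i / ω i) else 0 := by
    intro j
    rw [Finset.mul_sum, ← Finset.sum_filter]
    have hF : Finset.univ.filter (fun i => 0 < L i j) = Finset.univ.filter (fun i => L i j ≠ 0) := by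
      ext i; simp [lt_iff_le_and_ne, hL i j, eq_comm]
    rw [hF, ← hF]
    refine Finset.sum_le_sum fun i hi => ?_
    have hl : 0 < L i j := by simpa using hi
    have hw := hωpos i j hl
    have hv := hvpos j
    rw [hq i j hl, hp j]
    have e1 : (v j / S)⁻¹ * (ω i * L i j / v j * (1 / (n * (ω i * L i j / v j)) * D i j) ^ 2)
      = S / (n ^ 2 * ω i * L i j) * D i j ^ 2 := by field_simp
    have e2 : 2 * S / n ^ 2 * (Φ i / ω i) = S / (n ^ 2 * ω i * L i j) * (2 * L i j * Φ i) := by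
      field_simp
    rw [e1, e2]
    exact mul_le_mul_of_nonneg_left (hD i j) (by positivity)
  refine (Finset.sum_le_sum fun j _ => h1 j).trans ?_
  rw [Finset.sum_comm]
  have h2 : ∀ i, ∑ j, (if L i j ≠ 0 then 2 * S / n ^ 2 * (Φ i / ω i) else 0)
      ≤ 2 * S / n ^ 2 * Φ i := by
    intro i
    rw [← Finset.sum_filter, Finset.sum_const, nsmul_eq_mul, ← hω i]
    rcases eq_or_ne (ω i) 0 with h0 | h0
    · rw [h0, zero_mul]; have := hΦ i; positivity
    · apply le_of_eq; field_simp
  refine (Finset.sum_le_sum fun i _ => h2 i).trans ?_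
  rw [← Finset.mul_sum]
  apply le_of_eq; field_simp



/-- Lemma 6 of the paper (Recursion): one step of S2CD from `y` satisfies
`(1/2) E‖y − h p_j⁻¹ G^{ij} e_j − x*‖² + h(1 − 2hL̂)(f y − f x*)
  ≤ (1 − hμ)(1/2)‖y − x*‖² + 2h²L̂(f x̄ − f x*)`. -/
theorem stmt9 {n d : ℕ} (hn : 0 < n)
    (fi : Fin n → EuclideanSpace ℝ (Fin d) → ℝ)
    (hdiff : ∀ i, Differentiable ℝ (fi i))
    (hconv : ∀ i, ConvexOn ℝ Set.univ (fi i))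
    (L : Fin n → Fin d → ℝ) (hL : ∀ i j, 0 ≤ L i j)
    (hsmooth : ∀ (i : Fin n) (j : Fin d) (x : EuclideanSpace ℝ (Fin d)) (h : ℝ),
      fi i (x + h • EuclideanSpace.single j 1) ≤
        fi i x + ⟪gradient (fi i) x, h • EuclideanSpace.single j 1⟫ + L i j / 2 * h ^ 2)
    (f : EuclideanSpace ℝ (Fin d) → ℝ)
    (hf : ∀ x, f x = (1 / n : ℝ) * ∑ i, fi i x)
    (μ : ℝ) (hμ : 0 < μ)
    (hsc : ∀ x z : EuclideanSpace ℝ (Fin d),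
      f x + ⟪gradient f x, z - x⟫ + μ / 2 * ‖z - x‖ ^ 2 ≤ f z)
    (xstar : EuclideanSpace ℝ (Fin d)) (hmin : ∀ x, f xstar ≤ f x)
    (ω : Fin n → ℝ)
    (hω : ∀ i, ω i = ((Finset.univ.filter fun j => L i j ≠ 0).card : ℝ))
    (v : Fin d → ℝ) (hv : ∀ j, v j = ∑ i, ω i * L i j)
    (hvpos : ∀ j, 0 < v j)
    (p : Fin d → ℝ) (hp : ∀ j, p j = v j / ∑ s, v s)
    (q : Fin n → Fin d → ℝ)
    (hq : ∀ i j, 0 < L i j → q i j = ω i * L i j / v j)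
    (Lhat : ℝ) (hLhat : Lhat = (1 / n : ℝ) * ∑ j, v j)
    (h : ℝ) (hh : 0 < h)
    (y xbar : EuclideanSpace ℝ (Fin d))
    (G : Fin n → Fin d → ℝ)
    (hG : ∀ i j, 0 < L i j → G i j = gradient f xbar j +
      (1 / (n * q i j)) * (gradient (fi i) y j - gradient (fi i) xbar j)) :
    (1 / 2 : ℝ) * ∑ j, ∑ i ∈ Finset.univ.filter (fun i => 0 < L i j),
        p j * q i j *
          ‖y - (h * (p j)⁻¹ * G i j) • (EuclideanSpace.single j 1 : EuclideanSpace ℝ (Fin d))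
            - xstar‖ ^ 2
      + h * (1 - 2 * h * Lhat) * (f y - f xstar)
      ≤ (1 - h * μ) * ((1 / 2 : ℝ) * ‖y - xstar‖ ^ 2)
        + 2 * h ^ 2 * Lhat * (f xbar - f xstar) := by
  have hn' : (0:ℝ) < n := by exact_mod_cast hn
  rcases Nat.eq_zero_or_pos d with hd0 | hd0
  · subst hd0
    have e1 : y = xstar := Subsingleton.elim _ _
    have e2 : xbar = xstar := Subsingleton.elim _ _
    simp [e1, e2]
  have hS : 0 < ∑ s, v s :=
    Finset.sum_pos (fun j _ => hvpos j) ⟨⟨0, hd0⟩, Finset.mem_univ _⟩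
  generalize hSd : ∑ s, v s = S at *
  have hgf : ∀ x, gradient f x = (1 / n : ℝ) • ∑ i, gradient (fi i) x := by
    intro x
    apply HasGradientAt.gradient
    rw [hasGradientAt_iff_hasFDerivAt]
    have h1 : HasFDerivAt (fun x => (1 / n : ℝ) * ∑ i, fi i x)
        ((1 / n : ℝ) • ∑ i, fderiv ℝ (fi i) x) x :=
      (HasFDerivAt.fun_sum fun i _ => (hdiff i x).hasFDerivAt).const_mul _
    rw [show f = _ from funext hf]
    have h2 : (InnerProductSpace.toDual ℝ (EuclideanSpace ℝ (Fin d)))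
        ((1 / n : ℝ) • ∑ i, gradient (fi i) x) = (1 / n : ℝ) • ∑ i, fderiv ℝ (fi i) x := by
      ext z
      simp only [InnerProductSpace.toDual_apply_apply, inner_smul_left, sum_inner,
        inner_gradient_left, conj_trivial, ContinuousLinearMap.smul_apply,
        ContinuousLinearMap.sum_apply, smul_eq_mul]
    rw [h2]
    exact h1
  have hgj : ∀ x j, gradient f x j = (1 / n : ℝ) * ∑ i, gradient (fi i) x j := by
    intro x j
    rw [hgf]; simp
  have hg0 : gradient f xstar = 0 := by
    have : fderiv ℝ f xstar = 0 := IsLocalMin.fderiv_eq_zero (Filter.Eventually.of_forall hmin)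
    simp [gradient, this]
  have hco := fun i j x z => aux_coord (fi i) (hdiff i) (hconv i) j (L i j) (hsmooth i j) x z
  have hΦ : ∀ z i, 0 ≤ fi i z - fi i xstar - ⟪gradient (fi i) xstar, z - xstar⟫ := by
    intro z i
    linarith [aux_grad_ineq (fi i) (hdiff i) (hconv i) xstar z]
  have hΦs : ∀ z, (1 / n : ℝ) * ∑ i, (fi i z - fi i xstar - ⟪gradient (fi i) xstar, z - xstar⟫)
      = f z - f xstar := by
    intro z
    have h0 : ⟪gradient f xstar, z - xstar⟫ = 0 := by rw [hg0]; simp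
    rw [hgf, inner_smul_left, sum_inner] at h0
    simp only [conj_trivial] at h0
    rw [Finset.sum_sub_distrib, Finset.sum_sub_distrib, mul_sub, mul_sub, h0, hf z, hf xstar]
    ring
  have hsec := fun z => aux_second hn L ω hω hL v p hvpos S hS hp q hq
    (fun i j => gradient (fi i) z j - gradient (fi i) xstar j) _ (hΦ z)
    (fun i j => hco i j xstar z)
  simp only [hΦs, ← hLhat] at hsec
  have hωpos : ∀ i j, 0 < L i j → 0 < ω i := by
    intro i j h
    rw [hω]
    exact_mod_cast Finset.card_pos.2 ⟨j, by simp [h.ne']⟩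
  have hqpos : ∀ i j, 0 < L i j → 0 < q i j := by
    intro i j h
    rw [hq i j h]
    exact div_pos (mul_pos (hωpos i j h) h) (hvpos j)
  have hppos : ∀ j, 0 < p j := fun j => by rw [hp]; exact div_pos (hvpos j) hS
  have hL0 : ∀ i j, ¬ 0 < L i j → L i j = 0 := fun i j h => le_antisymm (not_lt.1 h) (hL i j)
  have hqsum : ∀ j, ∑ i ∈ Finset.univ.filter (fun i => 0 < L i j), q i j = 1 := by
    intro j
    rw [Finset.sum_congr rfl (fun i hi => hq i j (by simpa using hi)), ← Finset.sum_div,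
      div_eq_one_iff_eq (hvpos j).ne', hv j, Finset.sum_filter]
    refine Finset.sum_congr rfl fun i _ => ?_
    split_ifs with h0
    · rfl
    · rw [hL0 i j h0, mul_zero]
  have hpsum : ∑ j, p j = 1 := by
    simp only [hp]
    rw [← Finset.sum_div, hSd, div_self hS.ne']
  -- mean of differences
  have hmean : ∀ z w j, ∑ i ∈ Finset.univ.filter (fun i => 0 < L i j),
      q i j * (1 / (n * q i j) * (gradient (fi i) z j - gradient (fi i) w j))
      = gradient f z j - gradient f w j := by
    intro z w j
    rw [hgj, hgj, ← mul_sub, ← Finset.sum_sub_distrib, Finset.mul_sum, Finset.sum_filter]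
    refine Finset.sum_congr rfl fun i _ => ?_
    split_ifs with h0
    · have := hqpos i j h0
      field_simp
    · have := hco i j w z
      rw [hL0 i j h0] at this
      have h2 : gradient (fi i) z j - gradient (fi i) w j = 0 := by
        apply pow_eq_zero_iff (two_ne_zero) |>.1
        nlinarith [sq_nonneg (gradient (fi i) z j - gradient (fi i) w j)]
      rw [h2, mul_zero]
  have hvar : ∀ j, ∑ i ∈ Finset.univ.filter (fun i => 0 < L i j), q i j * G i j ^ 2 ≤
      2 * ∑ i ∈ Finset.univ.filter (fun i => 0 < L i j), q i j *
        (1 / (n * q i j) * (gradient (fi i) y j - gradient (fi i) xstar j)) ^ 2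
      + 2 * ∑ i ∈ Finset.univ.filter (fun i => 0 < L i j), q i j *
        (1 / (n * q i j) * (gradient (fi i) xbar j - gradient (fi i) xstar j)) ^ 2 := by
    intro j
    refine aux_var _ (fun i => q i j) (fun i => 1 / (n * q i j)) (fun i => G i j) 
      (fun i => gradient (fi i) y j - gradient (fi i) xstar j)
      (fun i => gradient (fi i) xbar j - gradient (fi i) xstar j) (gradient f xbar j)
      (fun i hi => (hqpos i j (by simpa using hi)).le) (hqsum j) ?_ ?_
    · have := hmean xbar xstar j
      rw [hg0] at this
      simpa using this
    · intro i hi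
      rw [hG i j (by simpa using hi)]
      ring
  have hGmean : ∀ j, ∑ i ∈ Finset.univ.filter (fun i => 0 < L i j), q i j * G i j
      = gradient f y j := by
    intro j
    have h1 : ∑ i ∈ Finset.univ.filter (fun i => 0 < L i j), q i j * G i j =
      ∑ i ∈ Finset.univ.filter (fun i => 0 < L i j), (q i j * gradient f xbar j +
        q i j * (1 / (n * q i j) * (gradient (fi i) y j - gradient (fi i) xbar j))) := by
      refine Finset.sum_congr rfl fun i hi => ?_
      rw [hG i j (by simpa using hi)]
      ring
    rw [h1, Finset.sum_add_distrib, ← Finset.sum_mul, hqsum, hmean]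
    ring
  have hexp : ∀ j, ∑ i ∈ Finset.univ.filter (fun i => 0 < L i j), p j * q i j *
          ‖y - (h * (p j)⁻¹ * G i j) • (EuclideanSpace.single j 1 : EuclideanSpace ℝ (Fin d))
            - xstar‖ ^ 2 = p j * ‖y - xstar‖ ^ 2 - 2 * h * (gradient f y j * (y - xstar) j)
          + h ^ 2 * ((p j)⁻¹ * ∑ i ∈ Finset.univ.filter (fun i => 0 < L i j),
            q i j * G i j ^ 2) := by
    intro j
    have h1 : ∀ i, p j * q i j *
          ‖y - (h * (p j)⁻¹ * G i j) • (EuclideanSpace.single j 1 : EuclideanSpace ℝ (Fin d))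
            - xstar‖ ^ 2 = p j * ‖y - xstar‖ ^ 2 * q i j
            - 2 * h * (y - xstar) j * (q i j * G i j)
            + h ^ 2 * (p j)⁻¹ * (q i j * G i j ^ 2) := by
      intro i
      rw [sub_right_comm, norm_sub_sq_real, inner_smul_right, EuclideanSpace.inner_single_right,
        norm_smul, mul_pow]
      have := (hppos j).ne'
      simp only [Real.norm_eq_abs, sq_abs, PiLp.norm_single, conj_trivial, abs_one]
      field_simp
    rw [Finset.sum_congr rfl fun i _ => h1 i, Finset.sum_add_distrib, Finset.sum_sub_distrib,
      ← Finset.mul_sum, ← Finset.mul_sum, ← Finset.mul_sum, hqsum, hGmean]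
    ring
  rw [Finset.sum_congr rfl fun j _ => hexp j, Finset.sum_add_distrib, Finset.sum_sub_distrib,
    ← Finset.sum_mul, ← Finset.mul_sum, ← Finset.mul_sum, hpsum]
  have hin : ∑ j, gradient f y j * (y - xstar) j = ⟪gradient f y, y - xstar⟫ := by
    rw [PiLp.inner_apply]
    refine Finset.sum_congr rfl fun j _ => ?_
    simp [mul_comm]
  have hT : ∑ j, (p j)⁻¹ * ∑ i ∈ Finset.univ.filter (fun i => 0 < L i j), q i j * G i j ^ 2
      ≤ 4 * Lhat * (f y - f xstar) + 4 * Lhat * (f xbar - f xstar) := by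
    have h1 := Finset.sum_le_sum fun j (_ : j ∈ Finset.univ) =>
      mul_le_mul_of_nonneg_left (hvar j) (inv_nonneg.2 (hppos j).le)
    simp only [mul_add, mul_left_comm _ (2:ℝ), Finset.sum_add_distrib] at h1
    rw [← Finset.mul_sum, ← Finset.mul_sum] at h1
    have a1 := hsec y
    have a2 := hsec xbar
    linarith
  have hsc' := hsc y xstar
  rw [← neg_sub y xstar, inner_neg_right, norm_neg] at hsc'
  rw [hin]
  have b1 := mul_le_mul_of_nonneg_left hT (sq_nonneg h)
  have b2 := mul_le_mul_of_nonneg_left hsc' hh.le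
  linarith
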